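/- In the polynomial ring ℤ[x₁,x₂,x₃], the degree-7 homogeneous component of ∏_{1≤i≤j≤l≤3} (1 + xᵢ + xⱼ + x_l) equals 72e₁⁵e₂ + 448e₁⁴e₃ + 464e₁³e₂² + 1386e₁²e₂e₃ + 259e₁e₂³ + 108e₁e₃² + 243e₂²e₃. -/

import Mathlib

open MvPolynomial

/-- `x₁`, `x₂`, `x₃` in `ℤ[x₁,x₂,x₃]`. -/
noncomputable def x1 : MvPolynomial (Fin 3) ℤ := X 0
noncomputable def x2 : MvPolynomial (Fin 3) ℤ := X 1
noncomputable def x3 : MvPolynomial (Fin 3) ℤ := X 2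

/-- the elementary symmetric polynomials in three variables -/
noncomputable def e1 : MvPolynomial (Fin 3) ℤ := x1 + x2 + x3
noncomputable def e2 : MvPolynomial (Fin 3) ℤ := x1*x2 + x1*x3 + x2*x3
noncomputable def e3 : MvPolynomial (Fin 3) ℤ := x1*x2*x3

/-- The product `∏_{1≤i≤j≤l≤3} (1 + xᵢ + xⱼ + x_l)` over the ten triples
`(i,j,l)` with `1 ≤ i ≤ j ≤ l ≤ 3`; by the splitting principle this is the
total Chern class of `S³E` for `E` of rank `3` with Chern roots `x₁,x₂,x₃`. -/
noncomputable def sym3Prod : MvPolynomial (Fin 3) ℤ :=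
  (1 + x1 + x1 + x1) * (1 + x1 + x1 + x2) * (1 + x1 + x1 + x3) *
  (1 + x1 + x2 + x2) * (1 + x1 + x2 + x3) * (1 + x1 + x3 + x3) *
  (1 + x2 + x2 + x2) * (1 + x2 + x2 + x3) * (1 + x2 + x3 + x3) *
  (1 + x3 + x3 + x3)

/-- The monomial `n e₁^a e₂^b e₃^k`. -/
noncomputable def chernTerm (n : ℤ) (a b k : ℕ) : MvPolynomial (Fin 3) ℤ :=
  (n : MvPolynomial (Fin 3) ℤ) * e1 ^ a * e2 ^ b * e3 ^ k

lemma e1_hom : e1.IsHomogeneous 1 :=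
  ((isHomogeneous_X _ _).add (isHomogeneous_X _ _)).add (isHomogeneous_X _ _)

lemma e2_hom : e2.IsHomogeneous 2 :=
  (((isHomogeneous_X _ _).mul (isHomogeneous_X _ _)).add
    ((isHomogeneous_X _ _).mul (isHomogeneous_X _ _))).add
    ((isHomogeneous_X _ _).mul (isHomogeneous_X _ _))

lemma e3_hom : e3.IsHomogeneous 3 :=
  ((isHomogeneous_X _ _).mul (isHomogeneous_X _ _)).mul (isHomogeneous_X _ _)

lemma chernTerm_hom (n : ℤ) (a b k : ℕ) :
    (chernTerm n a b k).IsHomogeneous (a + 2 * b + 3 * k) := by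
  have h0 : ((n : ℤ) : MvPolynomial (Fin 3) ℤ).IsHomogeneous 0 := by
    have := isHomogeneous_C (Fin 3) n
    simpa using this
  have h := ((h0.mul (e1_hom.pow a)).mul (e2_hom.pow b)).mul (e3_hom.pow k)
  have e : 0 + 1 * a + 2 * b + 3 * k = a + 2 * b + 3 * k := by ring
  rw [e] at h
  exact h

lemma component_chernTerm (n : ℤ) (a b k : ℕ) :
    homogeneousComponent 7 (chernTerm n a b k) =
      if a + 2 * b + 3 * k = 7 then chernTerm n a b k else 0 := by
  have h := homogeneousComponent_of_mem (m := 7)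
    ((mem_homogeneousSubmodule _ _).2 (chernTerm_hom n a b k))
  simpa [eq_comm] using h

set_option maxHeartbeats 4000000 in
set_option maxRecDepth 100000 in
/-- The total Chern class of `S³E` in terms of `e₁`, `e₂`, `e₃`. -/
lemma sym3Prod_eq : sym3Prod =
    (chernTerm 1 0 0 0) +
    (chernTerm 10 1 0 0) +
    (chernTerm 40 2 0 0 + chernTerm 15 0 1 0) +
    (chernTerm 82 3 0 0 + chernTerm 111 1 1 0 + chernTerm 27 0 0 1) +
    (chernTerm 91 4 0 0 + chernTerm 315 2 1 0 + chernTerm 63 0 2 0 + chernTerm 189 1 0 1) +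
    (chernTerm 52 5 0 0 + chernTerm 429 3 1 0 + chernTerm 324 1 2 0 + chernTerm 513 2 0 1 + chernTerm 162 0 1 1) +
    (chernTerm 12 6 0 0 + chernTerm 282 4 1 0 + chernTerm 593 2 2 0 + chernTerm 679 3 0 1 + chernTerm 85 0 3 0 + chernTerm 792 1 1 1 + chernTerm 27 0 0 2) +
    (chernTerm 72 5 1 0 + chernTerm 464 3 2 0 + chernTerm 448 4 0 1 + chernTerm 259 1 3 0 + chernTerm 1386 2 1 1 + chernTerm 243 0 2 1 + chernTerm 108 1 0 2) +
    (chernTerm 132 4 2 0 + chernTerm 120 5 0 1 + chernTerm 246 2 3 0 + chernTerm 1116 3 1 1 + chernTerm 36 0 4 0 + chernTerm 567 1 2 1 + chernTerm 81 2 0 2 + chernTerm 243 0 1 2) +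
    (chernTerm 72 3 3 0 + chernTerm 360 4 1 1 + chernTerm 36 1 4 0 + chernTerm 540 2 2 1 + chernTerm 108 3 0 2 + chernTerm 108 0 3 1 + chernTerm (-243) 1 1 2 + chernTerm 729 0 0 3) +
    (chernTerm 216 3 2 1 + chernTerm 108 4 0 2 + chernTerm 108 1 3 1 + chernTerm (-486) 2 1 2 + chernTerm 729 1 0 3) := by
  simp only [sym3Prod, chernTerm, e1, e2, e3]
  push_cast
  ring

/-- The paper's formula for `c_7(S³E)`: the degree-`7` homogeneous component
of `∏_{1≤i≤j≤l≤3} (1 + xᵢ + xⱼ + x_l)`. -/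
theorem chern_sym3_deg7 :
    homogeneousComponent 7 sym3Prod = 72*e1^5*e2 + 448*e1^4*e3 + 464*e1^3*e2^2 + 1386*e1^2*e2*e3 + 259*e1*e2^3 + 108*e1*e3^2 + 243*e2^2*e3 := by
  rw [sym3Prod_eq]
  simp only [map_add, component_chernTerm]
  norm_num
  simp only [chernTerm]
  push_cast
  ring
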